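/- arXiv:2301.08338 — 2 statements merged into one kernel-verified Lean document; each statement's English description precedes it below -/
import Mathlib

section
/- Let n ≥ 1, d > 0, and let (ν_k) be Borel probability measures on ℝⁿ such that each ν_k is supported in the closed ball B(z_k, d), where the centres z_k converge to some z ∈ ℝⁿ. Suppose ν_k converges weakly to a finite Borel measure α ≠ 0, and that (f_k) is a sequence of isometries of ℝⁿ such that the pushforwards (f_k)_♯ ν_k converge weakly to a finite Borel measure α′ ≠ 0. Then there exists an isometry f of ℝⁿ such that f_♯ α = α′. The same conclusion holds if the two convergences are setwise (ν_k(A) → α(A) and ((f_k)_♯ν_k)(A) → α′(A) for every Borel set A). -/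
open MeasureTheory Filter Topology
open scoped ENNReal

/-- A surjective isometry of a real normed space is an affine map with norm-preserving linear
part. -/
lemma exists_linear_part_of_surjective_isometry {E : Type*} [NormedAddCommGroup E]
    [NormedSpace ℝ E] {f : E → E} (hs : Function.Surjective f)
    (hf : ∀ x y, dist (f x) (f y) = dist x y) :
    ∃ L : E →L[ℝ] E, (∀ x, ‖L x‖ = ‖x‖) ∧ ∀ x, f x = L x + f 0 := by
  have hi : Isometry f := Isometry.of_dist_eq hf
  let e : E ≃ᵢ E := ⟨Equiv.ofBijective f ⟨hi.injective, hs⟩, hi⟩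
  refine ⟨e.toRealLinearIsometryEquiv.toContinuousLinearEquiv, fun x => ?_, fun x => ?_⟩
  · exact e.toRealLinearIsometryEquiv.norm_map x
  · have : e.toRealLinearIsometryEquiv x = f x - f 0 := e.toRealLinearIsometryEquiv_apply x
    exact sub_eq_iff_eq_add.1 this.symm

/-- Setwise convergence of probability measures implies weak convergence. -/
lemma tendsto_integral_of_tendsto_measure {Ω : Type*} [MeasurableSpace Ω] [TopologicalSpace Ω]
    [OpensMeasurableSpace Ω] {μ : ℕ → Measure Ω} [∀ k, IsProbabilityMeasure (μ k)]
    {β : Measure Ω}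
    (h : ∀ A, MeasurableSet A → Tendsto (fun k => μ k A) atTop (𝓝 (β A)))
    (φ : BoundedContinuousFunction Ω ℝ) :
    Tendsto (fun k => ∫ x, φ x ∂(μ k)) atTop (𝓝 (∫ x, φ x ∂β)) := by
  have hβ : IsProbabilityMeasure β := by
    refine ⟨tendsto_nhds_unique (h _ MeasurableSet.univ) ?_⟩
    simp
  let P : ProbabilityMeasure Ω := ⟨β, hβ⟩
  let M : ℕ → ProbabilityMeasure Ω := fun k => ⟨μ k, inferInstance⟩
  have hM : Tendsto M atTop (𝓝 P) :=
    tendsto_of_forall_isOpen_le_liminf fun G hG => by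
      have : Tendsto (fun k => M k G) atTop (𝓝 (P G)) := by
        rw [← ENNReal.tendsto_coe]
        simpa [M, P] using h G hG.measurableSet
      exact this.liminf_eq.ge
  exact ProbabilityMeasure.tendsto_iff_forall_integral_tendsto.1 hM φ

/-- Weak convergence of probability measures to `β ≠ 0` gives a ball charged by almost all of
them. -/
lemma exists_ball_eventually_pos {E : Type*} [NormedAddCommGroup E] [MeasurableSpace E]
    [BorelSpace E] {μ : ℕ → Measure E} [∀ k, IsProbabilityMeasure (μ k)] {β : Measure E}
    [IsFiniteMeasure β]
    (h : ∀ φ : BoundedContinuousFunction E ℝ,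
      Tendsto (fun k => ∫ x, φ x ∂(μ k)) atTop (𝓝 (∫ x, φ x ∂β))) :
    ∃ R : ℝ, ∀ᶠ k in atTop, 0 < μ k (Metric.ball 0 R) := by
  have hβ : IsProbabilityMeasure β := by
    have h1 := h (BoundedContinuousFunction.const E 1)
    simp only [BoundedContinuousFunction.const_apply, integral_const, probReal_univ, smul_eq_mul,
      mul_one] at h1
    have h2 := tendsto_nhds_unique h1 tendsto_const_nhds
    refine ⟨?_⟩
    rw [← ENNReal.toReal_eq_one_iff]
    exact h2
  obtain ⟨r, hr⟩ := exists_pos_ball (0 : E) (IsProbabilityMeasure.ne_zero β)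
  refine ⟨r, ?_⟩
  let P : ProbabilityMeasure E := ⟨β, hβ⟩
  let M : ℕ → ProbabilityMeasure E := fun k => ⟨μ k, inferInstance⟩
  have hM : Tendsto M atTop (𝓝 P) :=
    ProbabilityMeasure.tendsto_iff_forall_integral_tendsto.2 h
  have hl := ProbabilityMeasure.le_liminf_measure_open_of_tendsto hM
    (Metric.isOpen_ball (x := (0 : E)) (ε := r))
  exact eventually_lt_of_lt_liminf (lt_of_lt_of_le hr hl)

/-- If continuous functions `ψ k` converge to `ψ₀` uniformly on compact sets, and probability
measures `μ k` carried by a common compact set converge weakly to `β`, then `∫ ψ k ∂(μ k)`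
converges to `∫ ψ₀ ∂β`. -/
lemma tendsto_integral_of_tendsto_continuousMap {Ω : Type*} [MeasurableSpace Ω]
    [TopologicalSpace Ω] [OpensMeasurableSpace Ω] {K : Set Ω}
    (hK : IsCompact K) {μ : ℕ → Measure Ω} [∀ k, IsProbabilityMeasure (μ k)] {β : Measure Ω}
    (hμ : ∀ k, ∀ᵐ x ∂(μ k), x ∈ K) {ψ : ℕ → C(Ω, ℝ)} {ψ₀ : C(Ω, ℝ)}
    (hψ : Tendsto ψ atTop (𝓝 ψ₀)) (hint : ∀ k, Integrable (ψ k) (μ k))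
    (hint₀ : ∀ k, Integrable ψ₀ (μ k))
    (h : Tendsto (fun k => ∫ x, ψ₀ x ∂(μ k)) atTop (𝓝 (∫ x, ψ₀ x ∂β))) :
    Tendsto (fun k => ∫ x, ψ k x ∂(μ k)) atTop (𝓝 (∫ x, ψ₀ x ∂β)) := by
  have hu := ContinuousMap.tendsto_iff_forall_isCompact_tendstoUniformlyOn.1 hψ K hK
  have hd : Tendsto (fun k => ∫ x, ψ k x ∂(μ k) - ∫ x, ψ₀ x ∂(μ k)) atTop (𝓝 0) := by
    rw [Metric.tendsto_nhds]
    intro ε hε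
    filter_upwards [Metric.tendstoUniformlyOn_iff.1 hu (ε / 2) (half_pos hε)] with k hk
    rw [dist_zero_right, ← integral_sub (hint k) (hint₀ k)]
    have := norm_integral_le_of_norm_le_const (μ := μ k) (f := fun x => ψ k x - ψ₀ x)
      (C := ε / 2) (by
        filter_upwards [hμ k] with x hx
        rw [← dist_eq_norm, dist_comm]
        exact (hk x hx).le)
    rw [probReal_univ, mul_one] at this
    linarith
  simpa using hd.add h

/-- Weak limits of `ν k` and of its images under surjective isometries `f k` are isometric, if the
measures `ν k` are carried by balls with fixed radius and convergent centres. -/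
lemma exists_isometry_map_eq_of_tendsto_integral {E : Type*} [NormedAddCommGroup E]
    [NormedSpace ℝ E] [FiniteDimensional ℝ E] [MeasurableSpace E] [BorelSpace E]
    {d : ℝ} {ν : ℕ → Measure E} [∀ k, IsProbabilityMeasure (ν k)] {z : ℕ → E} {z₀ : E} (hz : Tendsto z atTop (𝓝 z₀))
    (hsupp : ∀ k, ν k (Metric.closedBall (z k) d)ᶜ = 0) {α α' : Measure E}
    [IsFiniteMeasure α] [IsFiniteMeasure α'] {f : ℕ → E → E}
    (hfsurj : ∀ k, Function.Surjective (f k))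
    (hfiso : ∀ k x y, dist (f k x) (f k y) = dist x y)
    (h : ∀ φ : BoundedContinuousFunction E ℝ,
      Tendsto (fun k => ∫ x, φ x ∂(ν k)) atTop (𝓝 (∫ x, φ x ∂α)))
    (h' : ∀ φ : BoundedContinuousFunction E ℝ,
      Tendsto (fun k => ∫ x, φ x ∂((ν k).map (f k))) atTop (𝓝 (∫ x, φ x ∂α'))) :
    ∃ g : E → E, Function.Surjective g ∧ (∀ x y, dist (g x) (g y) = dist x y) ∧
      α.map g = α' := by
  have : ProperSpace E := FiniteDimensional.proper_real E
  have : ProperSpace (E →L[ℝ] E) := FiniteDimensional.proper_real _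
  have hfm : ∀ k, Measurable (f k) := fun k =>
    (Isometry.of_dist_eq (hfiso k)).continuous.measurable
  have hpm : ∀ k, IsProbabilityMeasure ((ν k).map (f k)) := fun k =>
    Measure.isProbabilityMeasure_map (hfm k).aemeasurable
  choose L hL hfL using fun k => exists_linear_part_of_surjective_isometry (hfsurj k) (hfiso k)
  obtain ⟨C, hC⟩ : ∃ C, ∀ k, ‖z k‖ ≤ C := by
    obtain ⟨C, hC⟩ := (Metric.isBounded_range_of_tendsto z hz).exists_norm_le
    exact ⟨C, fun k => hC _ ⟨k, rfl⟩⟩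
  have hK : ∀ k, ∀ᵐ x ∂(ν k), x ∈ Metric.closedBall (0 : E) (C + d) := by
    intro k
    have hk : ∀ᵐ x ∂(ν k), x ∈ Metric.closedBall (z k) d := hsupp k
    filter_upwards [hk] with x hx
    rw [mem_closedBall_zero_iff]
    rw [mem_closedBall_iff_norm] at hx
    linarith [norm_le_norm_add_norm_sub' x (z k), hC k]
  obtain ⟨R, hR⟩ := exists_ball_eventually_pos h'
  have hf0 : ∀ᶠ k in atTop, ‖f k 0‖ ≤ R + (C + d) := by
    filter_upwards [hR] with k hk
    rw [Measure.map_apply (hfm k) Metric.isOpen_ball.measurableSet] at hk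
    obtain ⟨x, hx, hxK⟩ := ((frequently_ae_mem_iff.2 hk.ne').and_eventually (hK k)).exists
    rw [Set.mem_preimage, mem_ball_zero_iff] at hx
    rw [mem_closedBall_zero_iff] at hxK
    have h1 := norm_le_norm_add_norm_sub (f k x) (f k 0)
    have h2 := hfiso k x 0
    rw [dist_eq_norm, dist_zero_right] at h2
    linarith
  let p : ℕ → (E →L[ℝ] E) × E := fun k => (L k, f k 0)
  have hp : ∀ᶠ k in atTop, p k ∈ Metric.closedBall (0 : E →L[ℝ] E) 1 ×ˢ
      Metric.closedBall (0 : E) (R + (C + d)) := by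
    filter_upwards [hf0] with k hk
    refine ⟨?_, by simpa [p] using hk⟩
    rw [mem_closedBall_zero_iff]
    exact (L k).opNorm_le_bound zero_le_one fun x => by rw [hL k x, one_mul]
  obtain ⟨q, -, s, hs, hq⟩ := ((isCompact_closedBall _ _).prod
    (isCompact_closedBall _ _)).tendsto_subseq' hp.frequently
  have hq1 : ∀ x, ‖q.1 x‖ = ‖x‖ := fun x => by
    have h1 : Tendsto (fun k => ‖(p (s k)).1 x‖) atTop (𝓝 ‖q.1 x‖) :=
      ((by fun_prop : Continuous fun u : (E →L[ℝ] E) × E => ‖u.1 x‖).tendsto q).comp hq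
    refine tendsto_nhds_unique h1 ?_
    simp [p, hL]
  have hgi : ∀ x y, dist (q.1 x + q.2) (q.1 y + q.2) = dist x y := fun x y => by
    rw [dist_add_right, dist_eq_norm, ← map_sub, hq1, dist_eq_norm]
  have hgc : Continuous fun x => q.1 x + q.2 := by fun_prop
  have hqs : Function.Surjective q.1 :=
    (LinearMap.injective_iff_surjective (f := (q.1 : E →ₗ[ℝ] E))).1
      ((injective_iff_map_eq_zero (q.1 : E →ₗ[ℝ] E)).2 fun x hx => norm_eq_zero.1 <| by
        rw [← hq1 x]; simpa using hx)
  refine ⟨fun x => q.1 x + q.2, fun y => ?_, hgi, ?_⟩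
  · obtain ⟨x, hx⟩ := hqs (y - q.2)
    exact ⟨x, by simp [hx]⟩
  refine ext_of_forall_integral_eq_of_IsFiniteMeasure fun φ => ?_
  rw [integral_map hgc.aemeasurable φ.continuous.aestronglyMeasurable]
  let F : C(((E →L[ℝ] E) × E) × E, ℝ) :=
    ⟨fun u => φ (u.1.1 u.2 + u.1.2), φ.continuous.comp (by fun_prop)⟩
  have hF : Tendsto (fun k => F.curry (p (s k))) atTop (𝓝 (F.curry q)) :=
    (F.curry.continuous.tendsto q).comp hq
  have hint : ∀ (u : (E →L[ℝ] E) × E) k, Integrable (F.curry u) (ν k) := fun u k =>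
    (φ.compContinuous ⟨fun x => u.1 x + u.2, by fun_prop⟩).integrable (ν k)
  have hlim := tendsto_integral_of_tendsto_continuousMap (isCompact_closedBall _ _)
    (fun k => hK (s k)) hF (fun k => hint _ _) (fun k => hint _ _)
    ((h (φ.compContinuous ⟨fun x => q.1 x + q.2, hgc⟩)).comp hs.tendsto_atTop)
  refine tendsto_nhds_unique hlim (((h' φ).comp hs.tendsto_atTop).congr fun k => ?_)
  rw [Function.comp_apply,
    integral_map (hfm _).aemeasurable φ.continuous.aestronglyMeasurable]
  refine integral_congr_ae (Eventually.of_forall fun x => ?_)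
  exact congrArg φ (hfL (s k) x)

/-- Probability measures `ν_k` supported in balls `B(z_k, d)` with `z_k → z`,
converging weakly to `α ≠ 0`, pushed forward by isometries `f_k` converging weakly to
`α' ≠ 0`: then some isometry `f` satisfies `f_♯ α = α'`. Likewise for setwise convergence. -/
theorem stmt1 {n : ℕ} (hn : 1 ≤ n) (d : ℝ) (hd : 0 < d)
    (ν : ℕ → Measure (EuclideanSpace ℝ (Fin n)))
    (hν : ∀ k, IsProbabilityMeasure (ν k))
    (z : ℕ → EuclideanSpace ℝ (Fin n)) (z₀ : EuclideanSpace ℝ (Fin n))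
    (hz : Tendsto z atTop (nhds z₀))
    (hsupp : ∀ k, ν k (Metric.closedBall (z k) d)ᶜ = 0)
    (α α' : Measure (EuclideanSpace ℝ (Fin n)))
    (hαfin : IsFiniteMeasure α) (hα'fin : IsFiniteMeasure α')
    (hα : α ≠ 0) (hα' : α' ≠ 0)
    (f : ℕ → EuclideanSpace ℝ (Fin n) → EuclideanSpace ℝ (Fin n))
    (hfsurj : ∀ k, Function.Surjective (f k))
    (hfiso : ∀ k x y, dist (f k x) (f k y) = dist x y) :
    (((∀ φ : BoundedContinuousFunction (EuclideanSpace ℝ (Fin n)) ℝ,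
        Tendsto (fun k => ∫ x, φ x ∂(ν k)) atTop (nhds (∫ x, φ x ∂α))) ∧
      (∀ φ : BoundedContinuousFunction (EuclideanSpace ℝ (Fin n)) ℝ,
        Tendsto (fun k => ∫ x, φ x ∂((ν k).map (f k))) atTop (nhds (∫ x, φ x ∂α')))) →
      ∃ g : EuclideanSpace ℝ (Fin n) → EuclideanSpace ℝ (Fin n),
        Function.Surjective g ∧ (∀ x y, dist (g x) (g y) = dist x y) ∧ α.map g = α') ∧
    (((∀ A : Set (EuclideanSpace ℝ (Fin n)), MeasurableSet A →
        Tendsto (fun k => ν k A) atTop (nhds (α A))) ∧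
      (∀ A : Set (EuclideanSpace ℝ (Fin n)), MeasurableSet A →
        Tendsto (fun k => (ν k).map (f k) A) atTop (nhds (α' A)))) →
      ∃ g : EuclideanSpace ℝ (Fin n) → EuclideanSpace ℝ (Fin n),
        Function.Surjective g ∧ (∀ x y, dist (g x) (g y) = dist x y) ∧ α.map g = α') := by
  have hmap : ∀ k, IsProbabilityMeasure ((ν k).map (f k)) := fun k =>
    Measure.isProbabilityMeasure_map
      (Isometry.of_dist_eq (hfiso k)).continuous.measurable.aemeasurable
  refine ⟨fun h => ?_, fun h => ?_⟩
  · exact exists_isometry_map_eq_of_tendsto_integral hz hsupp hfsurj hfiso h.1 h.2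
  · exact exists_isometry_map_eq_of_tendsto_integral hz hsupp hfsurj hfiso
      (tendsto_integral_of_tendsto_measure h.1) (tendsto_integral_of_tendsto_measure h.2)
end

section
/- Assume Ψ satisfies the SOSC with feasible open set O and let μ_p be a self-similar measure with μ_p(∂O) = 0 (a known property of self-similar measures under the SOSC). Then for every finite word i over M: (i) μ_p(f_i(A)) = p_i · μ_p(A) for every μ_p-measurable set A ⊆ O; (ii) μ_p(f_i⁻¹(C)) = p_i⁻¹ · μ_p(C) for every μ_p-measurable set C ⊆ f_i(O). -/
open MeasureTheory Filter Topology
open scoped ENNReal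

noncomputable section

/-- `f` is a similarity of ratio `r`. -/
def IsSimilarityRatio {X : Type*} [MetricSpace X] (f : X → X) (r : ℝ) : Prop :=
  ∀ x y, dist (f x) (f y) = r * dist x y

/-- The composition `f_{i₁} ∘ ⋯ ∘ f_{i_k}` associated with a finite word. -/
def wordMap {X : Type*} {m : ℕ} (f : Fin m → X → X) : List (Fin m) → X → X
  | [] => id
  | j :: l => f j ∘ wordMap f l

/-- The product `p_{i₁} ⋯ p_{i_k}` associated with a finite word. -/
def wordProd {m : ℕ} (p : Fin m → ℝ) (l : List (Fin m)) : ℝ := (l.map p).prod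

lemma IsSimilarityRatio.continuous {X : Type*} [MetricSpace X] {f : X → X} {r : ℝ}
    (h : IsSimilarityRatio f r) : Continuous f :=
  (LipschitzWith.of_dist_le_mul (K := r.toNNReal) fun x y => by
    rw [h x y]
    exact mul_le_mul_of_nonneg_right (Real.le_coe_toNNReal r) dist_nonneg).continuous

lemma IsSimilarityRatio.injective {X : Type*} [MetricSpace X] {f : X → X} {r : ℝ}
    (h : IsSimilarityRatio f r) (hr : 0 < r) : Function.Injective f := fun x y hxy => by
  have hd := h x y
  rw [hxy, dist_self] at hd
  exact dist_eq_zero.1 ((mul_eq_zero.1 hd.symm).resolve_left hr.ne')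

lemma IsSimilarityRatio.infDist_le {X : Type*} [MetricSpace X] {f : X → X} {r : ℝ}
    (h : IsSimilarityRatio f r) (hr : 0 < r) {s : Set X} (hs : s.Nonempty)
    (hmap : f '' s ⊆ s) (x : X) :
    Metric.infDist (f x) s ≤ r * Metric.infDist x s := by
  rw [← div_le_iff₀' hr, Metric.le_infDist hs]
  intro y hy
  rw [div_le_iff₀' hr, ← h x y]
  exact Metric.infDist_le_dist_of_mem (hmap ⟨y, hy, rfl⟩)

lemma wordMap_continuous {X : Type*} [TopologicalSpace X] {m : ℕ} {f : Fin m → X → X}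
    (hf : ∀ i, Continuous (f i)) (l : List (Fin m)) : Continuous (wordMap f l) := by
  induction l with
  | nil => exact continuous_id
  | cons j l ih => exact (hf j).comp ih

lemma wordMap_injective {X : Type*} {m : ℕ} {f : Fin m → X → X}
    (hf : ∀ i, Function.Injective (f i)) (l : List (Fin m)) :
    Function.Injective (wordMap f l) := by
  induction l with
  | nil => exact Function.injective_id
  | cons j l ih => exact (hf j).comp ih

lemma wordMap_image_subset {X : Type*} {m : ℕ} {f : Fin m → X → X} {O : Set X}
    (hO : ∀ i, f i '' O ⊆ O) (l : List (Fin m)) : wordMap f l '' O ⊆ O := by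
  induction l with
  | nil => simp [wordMap]
  | cons j l ih =>
    rw [wordMap, Set.image_comp]
    exact (Set.image_mono ih).trans (hO j)

lemma wordProd_pos {m : ℕ} {p : Fin m → ℝ} (hp : ∀ i, 0 < p i) (l : List (Fin m)) :
    0 < wordProd p l :=
  List.prod_pos fun a ha => by
    obtain ⟨i, -, rfl⟩ := List.mem_map.1 ha
    exact hp i

/-- The attractor lies in the closure of every nonempty forward invariant set. -/
lemma attractor_subset_closure {X : Type*} [MetricSpace X] {m : ℕ} {f : Fin m → X → X}
    {r : Fin m → ℝ} (hr : ∀ i, r i ∈ Set.Ioo (0 : ℝ) 1)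
    (hsim : ∀ i, IsSimilarityRatio (f i) (r i)) {E : Set X} (hEcomp : IsCompact E)
    (hEattr : E = ⋃ i, f i '' E) {O : Set X} (hOne : O.Nonempty)
    (hOmap : ∀ i, f i '' O ⊆ O) : E ⊆ closure O := by
  intro x hx
  obtain ⟨x₀, hx₀, hmax⟩ :=
    hEcomp.exists_isMaxOn ⟨x, hx⟩ (Metric.continuous_infDist_pt O).continuousOn
  have hx₀' := hx₀
  rw [hEattr] at hx₀'
  obtain ⟨i, y, hy, hyx⟩ := Set.mem_iUnion.1 hx₀'
  have hcontr := (hsim i).infDist_le (hr i).1 hOne (hOmap i) y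
  rw [hyx] at hcontr
  have hy' : Metric.infDist y O ≤ Metric.infDist x₀ O := hmax hy
  have hx' : Metric.infDist x O ≤ Metric.infDist x₀ O := hmax hx
  have hx₀nonneg : 0 ≤ Metric.infDist x₀ O := Metric.infDist_nonneg
  have hxnonneg : 0 ≤ Metric.infDist x O := Metric.infDist_nonneg
  rw [Metric.mem_closure_iff_infDist_zero hOne]
  nlinarith [mul_le_mul_of_nonneg_left hy' (hr i).1.le, (hr i).2]

/-- Scaling of an invariant measure under a single map, when the images of the conull set `O`
are pairwise disjoint. -/
lemma measure_image_of_invariant {X : Type*} [MeasurableSpace X] {m : ℕ} {f : Fin m → X → X}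
    (hmeas : ∀ i, Measurable (f i)) (hinj : ∀ i, Function.Injective (f i)) {O : Set X}
    (hOdisj : ∀ i j, i ≠ j → Disjoint (f i '' O) (f j '' O)) {c : Fin m → ℝ≥0∞}
    {μ : Measure X} (hinv : μ = ∑ i, c i • μ.map (f i)) (hO : μ Oᶜ = 0) (i : Fin m)
    {A : Set X} (hA : MeasurableSet (f i '' A)) (hAO : A ⊆ O) :
    μ (f i '' A) = c i * μ A := by
  have hsum : μ (f i '' A) = ∑ j, c j * μ (f j ⁻¹' (f i '' A)) := by
    conv_lhs => rw [hinv]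
    simp [Measure.map_apply (hmeas _) hA]
  rw [hsum, Finset.sum_eq_single i, Set.preimage_image_eq _ (hinj i)]
  · intro j _ hji
    rw [measure_mono_null _ hO, mul_zero]
    rintro x ⟨a, ha, hax⟩ hx
    exact Set.disjoint_left.1 (hOdisj i j hji.symm) ⟨a, hAO ha, hax⟩ ⟨x, hx, rfl⟩
  · simp

/-- scaling of a self-similar measure under the SOSC:
`μ_p(f_i(A)) = p_i μ_p(A)` for measurable `A ⊆ O`, and
`μ_p(f_i⁻¹(C)) = p_i⁻¹ μ_p(C)` for measurable `C ⊆ f_i(O)`. -/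
theorem stmt2 {n m : ℕ} (hn : 1 ≤ n) (hm : 2 ≤ m)
    (f : Fin m → EuclideanSpace ℝ (Fin n) → EuclideanSpace ℝ (Fin n))
    (r : Fin m → ℝ) (hr : ∀ i, r i ∈ Set.Ioo (0 : ℝ) 1)
    (hsim : ∀ i, IsSimilarityRatio (f i) (r i))
    (E : Set (EuclideanSpace ℝ (Fin n))) (hEcomp : IsCompact E) (hEne : E.Nonempty)
    (hEattr : E = ⋃ i, f i '' E)
    (O : Set (EuclideanSpace ℝ (Fin n))) (hOopen : IsOpen O) (hOne : O.Nonempty)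
    (hOmap : ∀ i, f i '' O ⊆ O)
    (hOdisj : ∀ i j, i ≠ j → Disjoint (f i '' O) (f j '' O))
    (hOE : (O ∩ E).Nonempty)
    (p : Fin m → ℝ) (hp : ∀ i, 0 < p i) (hpsum : ∑ i, p i = 1)
    (μ : Measure (EuclideanSpace ℝ (Fin n))) (hprob : IsProbabilityMeasure μ)
    (hsupp : μ Eᶜ = 0)
    (hinv : μ = ∑ i, ENNReal.ofReal (p i) • μ.map (f i))
    (hfront : μ (frontier O) = 0)
    (l : List (Fin m)) :
    (∀ A : Set (EuclideanSpace ℝ (Fin n)), MeasurableSet A → A ⊆ O →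
        μ (wordMap f l '' A) = ENNReal.ofReal (wordProd p l) * μ A) ∧
    (∀ C : Set (EuclideanSpace ℝ (Fin n)), MeasurableSet C → C ⊆ wordMap f l '' O →
        μ (wordMap f l ⁻¹' C) = (ENNReal.ofReal (wordProd p l))⁻¹ * μ C) := by
  have hcont i := (hsim i).continuous
  have hinj i := (hsim i).injective (hr i).1
  have hEO := attractor_subset_closure hr hsim hEcomp hEattr hOne hOmap
  have hO : μ Oᶜ = 0 := by
    refine measure_mono_null (fun x hx => ?_) (measure_union_null hsupp hfront)
    by_cases hxE : x ∈ E
    · exact Or.inr ⟨hEO hxE, by rwa [hOopen.interior_eq]⟩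
    · exact Or.inl hxE
  have himage : ∀ (l : List (Fin m)) (A : Set (EuclideanSpace ℝ (Fin n))), MeasurableSet A →
      A ⊆ O → μ (wordMap f l '' A) = ENNReal.ofReal (wordProd p l) * μ A := by
    intro l A hA hAO
    induction l with
    | nil => simp [wordMap, wordProd]
    | cons j l ih =>
      have hmeas := hA.image_of_continuousOn_injOn
        (wordMap_continuous hcont (j :: l)).continuousOn (wordMap_injective hinj (j :: l)).injOn
      rw [wordMap, Set.image_comp] at hmeas ⊢
      rw [measure_image_of_invariant (fun i => (hcont i).measurable) hinj hOdisj hinv hO j hmeas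
        ((Set.image_mono hAO).trans (wordMap_image_subset hOmap l)), ih, ← mul_assoc,
        ← ENNReal.ofReal_mul (hp j).le]
      simp [wordProd]
  refine ⟨himage l, fun C hC hCO => ?_⟩
  have hpre : wordMap f l ⁻¹' C ⊆ O := by
    intro x hx
    obtain ⟨y, hy, hyx⟩ := hCO hx
    exact wordMap_injective hinj l hyx ▸ hy
  have hscale := himage l _ ((wordMap_continuous hcont l).measurable hC) hpre
  rw [Set.image_preimage_eq_of_subset (hCO.trans (Set.image_subset_range _ _))] at hscale
  rw [hscale, ← mul_assoc, ENNReal.inv_mul_cancel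
    (ENNReal.ofReal_pos.2 (wordProd_pos hp l)).ne' ENNReal.ofReal_ne_top, one_mul]
end
end
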